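/- arXiv:math/0511028 — 2 statements merged into one kernel-verified Lean document; each statement's English description precedes it below -/
import Mathlib

section
/- Suppose there exists c ∈ [1,∞) such that c^{−1} ≤ r(x) ≤ c for all x ∈ ℝ. Then the boundary value problem −r(x)y′(x)+q(x)y(x)=f(x), lim_{|x|→∞} y(x)=0, is correctly solvable in C(ℝ) if and only if for every a ∈ (0,∞) one has ∫_{x−a}^{x+a} q(t) dt → ∞ as |x| → ∞. -/
open MeasureTheory Filter Set Real
open scoped ENNReal NNReal

noncomputable section

/-- `y` is a solution of the boundary value problem `-r·y' + q·y = f` on `ℝ` with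
`y → 0` at `±∞`: `y` is continuous, locally absolutely continuous (encoded through the
integral identity, i.e. `y` is the integral of its a.e. derivative `(q·y - f)/r`),
and tends to `0` at both infinities. -/
def IsSolution (r q f y : ℝ → ℝ) : Prop :=
  Continuous y ∧
  (∀ a b : ℝ, y b - y a = ∫ t in a..b, (q t * y t - f t) / r t) ∧
  Tendsto y atBot (nhds 0) ∧ Tendsto y atTop (nhds 0)

/-- Correct solvability of the problem `-r·y' + q·y = f`, `y(±∞) = 0`, in `C(ℝ)`
(bounded continuous functions with the sup-norm): for every bounded continuous `f`
there is a unique solution `y` (such a solution is automatically bounded and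
continuous), and `sup|y| ≤ c·sup|f|` with a constant `c ∈ (0,∞)` independent of `f`. -/
def CorrectlySolvableC (r q : ℝ → ℝ) : Prop :=
  ∃ c : ℝ, 0 < c ∧
    ∀ f : ℝ → ℝ, Continuous f → (∃ M : ℝ, ∀ x, |f x| ≤ M) →
      (∃! y : ℝ → ℝ, IsSolution r q f y) ∧
      ∀ y : ℝ → ℝ, IsSolution r q f y → ∀ x, |y x| ≤ c * ⨆ t, |f t|


/-- Locally absolutely continuous, with the given a.e. derivative. -/
def ACD (u u' : ℝ → ℝ) : Prop :=
  (∀ a b, AbsolutelyContinuousOnInterval u a b) ∧ ∀ᵐ x, HasDerivAt u (u' x) x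

lemma li_ii {u : ℝ → ℝ} (h : LocallyIntegrable u volume) (a b : ℝ) :
    IntervalIntegrable u volume a b :=
  intervalIntegrable_iff.mpr <|
    (h.integrableOn_isCompact isCompact_uIcc).mono_set uIoc_subset_uIcc

lemma ACD.of_integral {u u' : ℝ → ℝ} (h : LocallyIntegrable u' volume)
    (hu : ∀ a b, u b - u a = ∫ t in a..b, u' t) : ACD u u' := by
  have key : ∀ a, u = fun x => (∫ t in a..x, u' t) - (fun _ => - u a) x := by
    intro a; funext x; have := hu a x; simp only; linarith
  refine ⟨fun a b => ?_, ?_⟩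
  · rw [key a]
    have hi : IntervalIntegrable u' volume a b := li_ii h _ _
    have h1 := hi.absolutelyContinuousOnInterval_intervalIntegral (c := a) (by simp)
    have h2 : AbsolutelyContinuousOnInterval (fun _ : ℝ => - u a) a b :=
      (contDiffOn_const).absolutelyContinuousOnInterval
    exact h1.sub h2
  · filter_upwards [_root_.LocallyIntegrable.ae_hasDerivAt_integral h] with x hx
    rw [key 0]
    simpa using (hx 0).sub_const (- u 0)

lemma ACD.integral {u u' : ℝ → ℝ} (h : ACD u u') (a b : ℝ) :
    u b - u a = ∫ t in a..b, u' t := by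
  rw [← (h.1 a b).integral_deriv_eq_sub]
  apply intervalIntegral.integral_congr_ae
  filter_upwards [h.2] with x hx _
  exact hx.deriv

lemma ACD.mul {u u' v v' : ℝ → ℝ} (h : ACD u u') (k : ACD v v') :
    ACD (fun x => u x * v x) (fun x => u' x * v x + u x * v' x) := by
  refine ⟨fun a b => (h.1 a b).mul (k.1 a b), ?_⟩
  filter_upwards [h.2, k.2] with x h1 h2 using h1.mul h2

lemma ACD.neg {u u' : ℝ → ℝ} (h : ACD u u') :
    ACD (fun x => - u x) (fun x => - u' x) := by
  refine ⟨fun a b => (h.1 a b).neg, ?_⟩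
  filter_upwards [h.2] with x h1 using h1.neg

lemma ac_exp {u : ℝ → ℝ} {a b : ℝ} (h : AbsolutelyContinuousOnInterval u a b) :
    AbsolutelyContinuousOnInterval (fun x => Real.exp (u x)) a b := by
  obtain ⟨C, hC⟩ := h.exists_bound
  obtain ⟨K, hK⟩ := (Real.contDiff_exp (n := 1)).contDiffOn.exists_lipschitzOnWith
    (s := Icc (-C) C) (by decide) (convex_Icc _ _) isCompact_Icc
  rw [absolutelyContinuousOnInterval_iff] at h ⊢
  intro ε hε
  obtain ⟨δ, hδ, H⟩ := h (ε / (K + 1)) (by positivity)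
  refine ⟨δ, hδ, fun E hE hEs => ?_⟩
  have := H E hE hEs
  have hm : ∀ x ∈ uIcc a b, u x ∈ Icc (-C) C := fun x hx => by
    have := hC x hx
    rw [Real.norm_eq_abs, abs_le] at this
    exact this
  calc _ ≤ ∑ i ∈ Finset.range E.1, (K : ℝ) * dist (u (E.2 i).1) (u (E.2 i).2) := by
        apply Finset.sum_le_sum
        intro i hi
        exact hK.dist_le_mul _ (hm _ (hE.1 i hi).1) _ (hm _ (hE.1 i hi).2)
    _ = K * ∑ i ∈ Finset.range E.1, dist (u (E.2 i).1) (u (E.2 i).2) := by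
        rw [Finset.mul_sum]
    _ ≤ K * (ε / (K + 1)) := by gcongr
    _ < (K + 1) * (ε / (K + 1)) := by gcongr; linarith
    _ = ε := by field

lemma ACD.exp {u u' : ℝ → ℝ} (h : ACD u u') :
    ACD (fun x => Real.exp (u x)) (fun x => Real.exp (u x) * u' x) := by
  refine ⟨fun a b => ac_exp (h.1 a b), ?_⟩
  filter_upwards [h.2] with x h1 using h1.exp

lemma ACD.continuous {u u' : ℝ → ℝ} (h : ACD u u') : Continuous u := by
  rw [continuous_iff_continuousAt]
  intro x
  have := (h.1 (x - 1) (x + 1)).continuousOn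
  apply this.continuousAt
  rw [uIcc_of_le (by linarith)]
  exact Icc_mem_nhds (by linarith) (by linarith)

lemma growth {P : ℝ → ℝ} (hP : Monotone P) {N : ℝ} (hN : 0 ≤ N)
    (h : ∀ x, N ≤ |x| → 1 ≤ P (x + 1) - P x) :
    ∃ D, ∀ x t, x ≤ t → t - x - D ≤ P t - P x := by
  let κ : ℝ → ℝ := fun x => max (-N) (min x (N + 1))
  have hκm : Monotone κ := fun x y hxy => max_le_max le_rfl (min_le_min hxy le_rfl)
  have hκ1 : ∀ x, -N ≤ κ x := fun x => le_max_left _ _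
  have hκ2 : ∀ x, κ x ≤ N + 1 := fun x => max_le (by linarith) (min_le_right _ _)
  let H : ℝ → ℝ := fun x => P x - x + κ x
  have step : ∀ x, H x ≤ H (x + 1) := by
    intro x
    by_cases hx : N ≤ |x|
    · have := h x hx
      have := hκm (show x ≤ x + 1 by linarith)
      simp only [H]; linarith
    · push Not at hx
      rw [abs_lt] at hx
      have e1 : κ x = x := by
        simp only [κ]; rw [min_eq_left (by linarith), max_eq_right (by linarith)]
      have e2 : κ (x + 1) = x + 1 := by
        simp only [κ]; rw [min_eq_left (by linarith), max_eq_right (by linarith)]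
      have := hP (show x ≤ x + 1 by linarith)
      simp only [H, e1, e2]; linarith
  have stepn : ∀ (n : ℕ) x, H x ≤ H (x + n) := by
    intro n x
    induction n with
    | zero => simp
    | succ k ih =>
      have := step (x + k)
      push_cast
      rw [← add_assoc]; linarith
  refine ⟨2 * N + 2, fun x t hxt => ?_⟩
  have h1 := stepn ⌊t - x⌋₊ x
  have h2 := Nat.floor_le (show 0 ≤ t - x by linarith)
  have h3 := Nat.lt_floor_add_one (t - x)
  have h4 := hP (show x + (⌊t - x⌋₊ : ℝ) ≤ t by linarith)
  have h5 := hκ1 x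
  have h6 := hκ2 (x + (⌊t - x⌋₊ : ℝ))
  simp only [H] at h1
  linarith

section main
variable {r q : ℝ → ℝ}

/-- The antiderivative of `q / r`. -/
def PP (r q : ℝ → ℝ) (x : ℝ) : ℝ := ∫ t in (0:ℝ)..x, q t / r t

lemma li_mul {q g : ℝ → ℝ} (hq : LocallyIntegrable q volume) (hg : Continuous g) :
    LocallyIntegrable (fun t => q t * g t) volume := by
  rw [locallyIntegrable_iff]
  intro k hk
  exact (hq.integrableOn_isCompact hk).mul_continuousOn hg.continuousOn hk

lemma li_p (hr : Continuous r) (hrpos : ∀ x, 0 < r x)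
    (hq : LocallyIntegrable q volume) : LocallyIntegrable (fun t => q t / r t) volume := by
  simp only [div_eq_mul_inv]
  exact li_mul hq (hr.inv₀ fun x => (hrpos x).ne')

lemma PP_sub (hr : Continuous r) (hrpos : ∀ x, 0 < r x)
    (hq : LocallyIntegrable q volume) (a b : ℝ) :
    PP r q b - PP r q a = ∫ t in a..b, q t / r t :=
  intervalIntegral.integral_interval_sub_left (li_ii (li_p hr hrpos hq) _ _)
    (li_ii (li_p hr hrpos hq) _ _)

lemma PP_acd (hr : Continuous r) (hrpos : ∀ x, 0 < r x)
    (hq : LocallyIntegrable q volume) : ACD (PP r q) (fun t => q t / r t) :=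
  ACD.of_integral (li_p hr hrpos hq) (PP_sub hr hrpos hq)

lemma PP_mono (hr : Continuous r) (hrpos : ∀ x, 0 < r x)
    (hq : LocallyIntegrable q volume) (hqnn : ∀ x, 0 ≤ q x) : Monotone (PP r q) := by
  intro a b hab
  have := PP_sub hr hrpos hq a b
  have h2 : 0 ≤ ∫ t in a..b, q t / r t :=
    intervalIntegral.integral_nonneg hab fun x _ => div_nonneg (hqnn x) (hrpos x).le
  linarith

lemma PP_bounds (hr : Continuous r) (hrpos : ∀ x, 0 < r x)
    (hq : LocallyIntegrable q volume) (hqnn : ∀ x, 0 ≤ q x)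
    {c : ℝ} (hc : 1 ≤ c) (hrc : ∀ x, c⁻¹ ≤ r x ∧ r x ≤ c) {a b : ℝ} (hab : a ≤ b) :
    (∫ t in a..b, q t) ≤ c * (PP r q b - PP r q a) ∧
    PP r q b - PP r q a ≤ c * ∫ t in a..b, q t := by
  have i1 : IntervalIntegrable q volume a b := li_ii hq _ _
  have i2 : IntervalIntegrable (fun t => q t / r t) volume a b :=
    (li_ii (li_p hr hrpos hq) _ _)
  have hc0 : 0 < c := by linarith
  rw [PP_sub hr hrpos hq, ← intervalIntegral.integral_const_mul,
    ← intervalIntegral.integral_const_mul]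
  constructor
  · apply intervalIntegral.integral_mono_on hab i1 (i2.const_mul c)
    intro x _
    rw [← mul_div_assoc, le_div_iff₀ (hrpos x), mul_comm]
    exact mul_le_mul_of_nonneg_right (hrc x).2 (hqnn x)
  · apply intervalIntegral.integral_mono_on hab i2 (i1.const_mul c)
    intro x _
    rw [div_le_iff₀ (hrpos x)]
    have : 1 ≤ c * r x := by
      have := mul_le_mul_of_nonneg_left (hrc x).1 hc0.le
      rwa [mul_inv_cancel₀ hc0.ne'] at this
    have := mul_le_mul_of_nonneg_left this (hqnn x)
    linarith

/-- The transformed identity for a solution. -/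
lemma sol_forward (hr : Continuous r) (hrpos : ∀ x, 0 < r x)
    (hq : LocallyIntegrable q volume) {f y : ℝ → ℝ} (hf : Continuous f)
    (hy : IsSolution r q f y) (a b : ℝ) :
    y b * Real.exp (-PP r q b) - y a * Real.exp (-PP r q a)
      = - ∫ t in a..b, Real.exp (-PP r q t) * (f t / r t) := by
  have li : LocallyIntegrable (fun t => (q t * y t - f t) / r t) volume :=
    li_p hr hrpos ((li_mul hq hy.1).sub hf.locallyIntegrable)
  have A := (ACD.of_integral li hy.2.1).mul (PP_acd hr hrpos hq).neg.exp
  have B := A.integral a b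
  rw [B, ← intervalIntegral.integral_neg]
  congr 1
  funext t
  have := (hrpos t).ne'
  field_simp
  ring

lemma sol_backward (hr : Continuous r) (hrpos : ∀ x, 0 < r x)
    (hq : LocallyIntegrable q volume) {f I : ℝ → ℝ} (hf : Continuous f)
    (hI : ∀ a b, I b - I a = ∫ t in a..b, - (Real.exp (-PP r q t) * (f t / r t))) :
    Continuous (fun x => I x * Real.exp (PP r q x)) ∧
    ∀ a b, I b * Real.exp (PP r q b) - I a * Real.exp (PP r q a)
      = ∫ t in a..b, (q t * (I t * Real.exp (PP r q t)) - f t) / r t := by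
  have hPc := (PP_acd hr hrpos hq).continuous
  have li : LocallyIntegrable (fun t => - (Real.exp (-PP r q t) * (f t / r t))) volume := by
    apply Continuous.locallyIntegrable
    exact ((Real.continuous_exp.comp hPc.neg).mul (hf.div hr fun x => (hrpos x).ne')).neg
  have A := (ACD.of_integral li hI).mul (PP_acd hr hrpos hq).exp
  refine ⟨A.continuous, fun a b => ?_⟩
  rw [A.integral a b]
  congr 1
  funext t
  have := (hrpos t).ne'
  have e : Real.exp (-PP r q t) * Real.exp (PP r q t) = 1 := by
    rw [← Real.exp_add]; simp
  have : -(Real.exp (-PP r q t) * (f t / r t)) * Real.exp (PP r q t) = - (f t / r t) := by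
    linear_combination (- (f t / r t)) * e
  rw [this]
  field_simp
  ring

lemma z_tendsto (hr : Continuous r) (hrpos : ∀ x, 0 < r x)
    (hq : LocallyIntegrable q volume) (hqnn : ∀ x, 0 ≤ q x) {y : ℝ → ℝ}
    (hy : Tendsto y atTop (nhds 0)) :
    Tendsto (fun x => y x * Real.exp (-PP r q x)) atTop (nhds 0) := by
  apply squeeze_zero_norm' _ (by simpa using hy.norm)
  filter_upwards [eventually_ge_atTop 0] with x hx
  have h0 : PP r q 0 = 0 := by simp [PP]
  have := PP_mono hr hrpos hq hqnn hx
  rw [norm_mul, Real.norm_eq_abs (Real.exp _), abs_of_pos (Real.exp_pos _)]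
  apply mul_le_of_le_one_right (norm_nonneg _)
  rw [Real.exp_le_one_iff]; linarith

lemma sol_unique (hr : Continuous r) (hrpos : ∀ x, 0 < r x)
    (hq : LocallyIntegrable q volume) (hqnn : ∀ x, 0 ≤ q x) {f y w : ℝ → ℝ}
    (hf : Continuous f) (hy : IsSolution r q f y) (hw : IsSolution r q f w) : y = w := by
  funext x
  have t1 := z_tendsto hr hrpos hq hqnn hy.2.2.2
  have t2 := z_tendsto hr hrpos hq hqnn hw.2.2.2
  have t3 := t1.sub t2
  have : ∀ b, y b * Real.exp (-PP r q b) - w b * Real.exp (-PP r q b)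
      = (y x - w x) * Real.exp (-PP r q x) := by
    intro b
    have h1 := sol_forward hr hrpos hq hf hy x b
    have h2 := sol_forward hr hrpos hq hf hw x b
    linarith
  simp only [this] at t3
  have := tendsto_nhds_unique t3 tendsto_const_nhds
  have h3 := (Real.exp_pos (-PP r q x)).ne'
  simp only [sub_zero] at this
  have h4 := (mul_eq_zero.1 this.symm).resolve_right h3
  linarith

lemma necessity (hr : Continuous r) (hrpos : ∀ x, 0 < r x)
    (hq : LocallyIntegrable q volume) (hqnn : ∀ x, 0 ≤ q x)
    {c : ℝ} (hc : 1 ≤ c) (hrc : ∀ x, c⁻¹ ≤ r x ∧ r x ≤ c) {y : ℝ → ℝ}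
    (hy : IsSolution r q (fun _ => 1) y) {a : ℝ} (ha : 0 < a) (x : ℝ) :
    0 < y (x - a) ∧
    Real.log (2 * a / c * (y (x - a))⁻¹) ≤ c * ∫ t in (x - a)..(x + a), q t := by
  have hc0 : 0 < c := by linarith
  have hPc := (PP_acd hr hrpos hq).continuous
  have hcont : Continuous fun t => Real.exp (-PP r q t) * (1 / r t) :=
    (Real.continuous_exp.comp hPc.neg).mul (continuous_const.div hr fun x => (hrpos x).ne')
  have hF := sol_forward hr hrpos hq continuous_const hy
  have hnn : 0 ≤ y (x + a) * Real.exp (-PP r q (x + a)) := by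
    apply le_of_tendsto (z_tendsto hr hrpos hq hqnn hy.2.2.2)
    filter_upwards [eventually_ge_atTop (x + a)] with b hb
    have h1 := hF (x + a) b
    have h2 : 0 ≤ ∫ t in (x+a)..b, Real.exp (-PP r q t) * (1 / r t) :=
      intervalIntegral.integral_nonneg hb fun t _ =>
        mul_nonneg (Real.exp_pos _).le (one_div_pos.2 (hrpos t)).le
    linarith
  have hlow : 2 * a / c * Real.exp (-PP r q (x + a)) ≤
      ∫ t in (x - a)..(x + a), Real.exp (-PP r q t) * (1 / r t) := by
    have e : (∫ t in (x - a)..(x + a), Real.exp (-PP r q (x + a)) * (1 / c))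
        = 2 * a / c * Real.exp (-PP r q (x + a)) := by
      rw [intervalIntegral.integral_const, smul_eq_mul]; field_simp; ring
    rw [← e]
    apply intervalIntegral.integral_mono_on (by linarith) (by simp)
      (hcont.intervalIntegrable _ _)
    intro t ht
    apply mul_le_mul _ _ (by positivity) (Real.exp_pos _).le
    · rw [Real.exp_le_exp]
      have := PP_mono hr hrpos hq hqnn ht.2
      linarith
    · exact one_div_le_one_div_of_le (hrpos t) (hrc t).2
  have h1 := hF (x - a) (x + a)
  have key : 2 * a / c * Real.exp (-PP r q (x + a)) ≤ y (x - a) * Real.exp (-PP r q (x - a)) := by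
    linarith
  have hpos : 0 < y (x - a) := by
    have : 0 < 2 * a / c * Real.exp (-PP r q (x + a)) := by positivity
    exact pos_of_mul_pos_left (lt_of_lt_of_le this key) (Real.exp_pos _).le
  refine ⟨hpos, ?_⟩
  have h2 := (PP_bounds hr hrpos hq hqnn hc hrc (show x - a ≤ x + a by linarith)).2
  refine le_trans ?_ h2
  rw [Real.log_le_iff_le_exp (by positivity), Real.exp_sub]
  rw [Real.exp_neg, Real.exp_neg] at key
  have p1 := Real.exp_pos (PP r q (x + a))
  have p2 := Real.exp_pos (PP r q (x - a))
  rw [le_div_iff₀ p2, ← div_eq_mul_inv, div_mul_eq_mul_div, div_le_iff₀ hpos]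
  rw [← div_eq_mul_inv, ← div_eq_mul_inv, div_le_div_iff₀ p1 p2] at key
  linarith

lemma nec_tendsto (hr : Continuous r) (hrpos : ∀ x, 0 < r x)
    (hq : LocallyIntegrable q volume) (hqnn : ∀ x, 0 ≤ q x)
    {c : ℝ} (hc : 1 ≤ c) (hrc : ∀ x, c⁻¹ ≤ r x ∧ r x ≤ c) {y : ℝ → ℝ}
    (hy : IsSolution r q (fun _ => 1) y) {a : ℝ} (ha : 0 < a) {l : Filter ℝ}
    (hl : Tendsto (fun x => y (x - a)) l (nhds 0)) :
    Tendsto (fun x => ∫ t in (x - a)..(x + a), q t) l atTop := by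
  have hc0 : 0 < c := by linarith
  have H := fun x => necessity hr hrpos hq hqnn hc hrc hy ha x
  have h1 : Tendsto (fun x => y (x - a)) l (nhdsWithin 0 (Ioi 0)) :=
    tendsto_nhdsWithin_iff.2 ⟨hl, Eventually.of_forall fun x => (H x).1⟩
  have h2 := (Real.tendsto_log_atTop.comp
    ((tendsto_inv_nhdsGT_zero.comp h1).const_mul_atTop (show 0 < 2 * a / c by positivity)))
  have h3 := tendsto_atTop_mono (fun x => (H x).2) h2
  have h4 := h3.const_mul_atTop (inv_pos.2 hc0)
  refine h4.congr fun x => ?_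
  rw [inv_mul_cancel_left₀ hc0.ne']

lemma sufficiency (hr : Continuous r) (hrpos : ∀ x, 0 < r x)
    (hq : LocallyIntegrable q volume) (hqnn : ∀ x, 0 ≤ q x)
    {c : ℝ} (hc : 1 ≤ c) (hrc : ∀ x, c⁻¹ ≤ r x ∧ r x ≤ c)
    (hT : ∀ a, 0 < a → Tendsto (fun x => PP r q (x + a) - PP r q x) atTop atTop ∧
      Tendsto (fun x => PP r q (x + a) - PP r q x) atBot atTop) :
    ∃ B : ℝ, 0 < B ∧ ∀ f : ℝ → ℝ, Continuous f → ∀ M, (∀ x, |f x| ≤ M) →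
      ∃ y, IsSolution r q f y ∧ ∀ x, |y x| ≤ B * M := by
  have hc0 : 0 < c := by linarith
  have hPm := PP_mono hr hrpos hq hqnn
  have hPc := (PP_acd hr hrpos hq).continuous
  set P := PP r q with hPdef
  obtain ⟨D, hD⟩ : ∃ D, ∀ x t, x ≤ t → t - x - D ≤ P t - P x := by
    obtain ⟨N1, h1⟩ := eventually_atTop.1 ((hT 1 one_pos).1.eventually_ge_atTop 1)
    obtain ⟨N2, h2⟩ := eventually_atBot.1 ((hT 1 one_pos).2.eventually_ge_atTop 1)
    apply growth hPm (N := max 0 (max N1 (-N2))) (le_max_left _ _)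
    intro x hx
    have hx1 : N1 ≤ |x| := le_trans (le_trans (le_max_left _ _) (le_max_right _ _)) hx
    have hx2 : -N2 ≤ |x| := le_trans (le_trans (le_max_right _ _) (le_max_right _ _)) hx
    rcases abs_cases x with h | h
    · exact h1 x (by linarith)
    · exact h2 x (by linarith)
  have hEc : Continuous fun t => Real.exp (-P t) := Real.continuous_exp.comp hPc.neg
  have bnd : ∀ x t, x ≤ t → Real.exp (-P t) ≤ Real.exp (D + x - P x) * Real.exp (-t) := by
    intro x t hxt
    rw [← Real.exp_add, Real.exp_le_exp]
    have := hD x t hxt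
    linarith
  have hgi : ∀ x, IntegrableOn (fun t => Real.exp (D + x - P x) * Real.exp (-t)) (Ioi x) :=
    fun x => (integrableOn_exp_neg_Ioi x).const_mul _
  have hEi : ∀ x, IntegrableOn (fun t => Real.exp (-P t)) (Ioi x) := by
    intro x
    refine Integrable.mono' (hgi x) hEc.aestronglyMeasurable ?_
    filter_upwards [ae_restrict_mem measurableSet_Ioi] with t ht
    rw [Real.norm_eq_abs, abs_of_pos (Real.exp_pos _)]
    exact bnd x t (le_of_lt ht)
  have hE1 : ∀ x, ∫ t in Ioi x, Real.exp (-P t) ≤ Real.exp D * Real.exp (-P x) := by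
    intro x
    have : ∫ t in Ioi x, Real.exp (-P t) ≤
        ∫ t in Ioi x, Real.exp (D + x - P x) * Real.exp (-t) :=
      setIntegral_mono_on (hEi x) (hgi x) measurableSet_Ioi fun t ht => bnd x t (le_of_lt ht)
    refine this.trans (le_of_eq ?_)
    rw [integral_const_mul, integral_exp_neg_Ioi, ← Real.exp_add, ← Real.exp_add]
    congr 1; ring
  have hE2 : ∀ a, 0 < a → ∀ x, ∫ t in Ioi x, Real.exp (-P t) ≤
      a * Real.exp (-P x) + Real.exp D * Real.exp (-P (x + a)) := by
    intro a ha x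
    rw [← intervalIntegral.integral_interval_add_Ioi (hEi x) (hEi (x + a))]
    apply add_le_add _ (hE1 (x + a))
    have : ∫ t in x..(x+a), Real.exp (-P t) ≤ ∫ t in x..(x+a), Real.exp (-P x) := by
      apply intervalIntegral.integral_mono_on (by linarith) (hEc.intervalIntegrable _ _) (by simp)
      intro t ht
      rw [Real.exp_le_exp]
      have := hPm ht.1
      linarith
    simpa using this
  refine ⟨c * Real.exp D, by positivity, fun f hf M hM => ?_⟩
  have hM0 : 0 ≤ M := (abs_nonneg _).trans (hM 0)
  have hgc : Continuous fun t => Real.exp (-P t) * (f t / r t) :=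
    hEc.mul (hf.div hr fun x => (hrpos x).ne')
  have hgb : ∀ t, ‖Real.exp (-P t) * (f t / r t)‖ ≤ (c * M) * Real.exp (-P t) := by
    intro t
    rw [norm_mul, Real.norm_eq_abs, Real.norm_eq_abs, abs_of_pos (Real.exp_pos _), mul_comm,
      abs_div, abs_of_pos (hrpos t)]
    apply mul_le_mul_of_nonneg_right _ (Real.exp_pos _).le
    rw [div_le_iff₀ (hrpos t)]
    have h1 : 1 ≤ c * r t := by
      have := mul_le_mul_of_nonneg_left (hrc t).1 hc0.le
      rwa [mul_inv_cancel₀ hc0.ne'] at this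
    have := mul_le_mul_of_nonneg_left h1 hM0
    linarith [hM t]
  have hgint : ∀ x, IntegrableOn (fun t => Real.exp (-P t) * (f t / r t)) (Ioi x) := fun x =>
    Integrable.mono' ((hEi x).const_mul (c * M)) hgc.aestronglyMeasurable
      (Eventually.of_forall hgb)
  let I : ℝ → ℝ := fun x => ∫ t in Ioi x, Real.exp (-P t) * (f t / r t)
  have hIb : ∀ x, |I x| ≤ c * M * ∫ t in Ioi x, Real.exp (-P t) := by
    intro x
    rw [← integral_const_mul]
    exact norm_integral_le_of_norm_le ((hEi x).const_mul (c * M)) (Eventually.of_forall hgb)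
  have hI : ∀ a b, I b - I a = ∫ t in a..b, - (Real.exp (-P t) * (f t / r t)) := by
    intro a b
    have := intervalIntegral.integral_Ioi_sub_Ioi' (hgint a) (hgint b)
    rw [intervalIntegral.integral_neg, ← this]
    simp only [I]; ring
  obtain ⟨B1, B2⟩ := sol_backward hr hrpos hq hf hI
  have hy1 : ∀ x, |I x * Real.exp (P x)| ≤ c * Real.exp D * M := by
    intro x
    rw [abs_mul, abs_of_pos (Real.exp_pos _)]
    have e : Real.exp (-P x) * Real.exp (P x) = 1 := by rw [← Real.exp_add]; simp
    calc |I x| * Real.exp (P x)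
        ≤ (c * M * (Real.exp D * Real.exp (-P x))) * Real.exp (P x) := by
          gcongr
          exact (hIb x).trans (by gcongr; exact hE1 x)
      _ = c * Real.exp D * M := by linear_combination (c * M * Real.exp D) * e
  have hy2 : ∀ a, 0 < a → ∀ x, |I x * Real.exp (P x)| ≤
      c * M * (a + Real.exp D * Real.exp (-(P (x + a) - P x))) := by
    intro a ha x
    rw [abs_mul, abs_of_pos (Real.exp_pos _)]
    have e : Real.exp (-P x) * Real.exp (P x) = 1 := by rw [← Real.exp_add]; simp
    have e2 : Real.exp (-(P (x + a) - P x)) = Real.exp (-P (x + a)) * Real.exp (P x) := by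
      rw [← Real.exp_add]; congr 1; ring
    calc |I x| * Real.exp (P x)
        ≤ (c * M * (a * Real.exp (-P x) + Real.exp D * Real.exp (-P (x + a)))) * Real.exp (P x) := by
          gcongr
          exact (hIb x).trans (by gcongr; exact hE2 a ha x)
      _ = _ := by rw [e2]; linear_combination (c * M * a) * e
  have lim : ∀ l : Filter ℝ, (∀ a, 0 < a → Tendsto (fun x => P (x + a) - P x) l atTop) →
      Tendsto (fun x => I x * Real.exp (P x)) l (nhds 0) := by
    intro l hl
    rw [Metric.tendsto_nhds]
    intro ε hε
    have ha : 0 < ε / (2 * (c * M + 1)) := by positivity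
    have t1 : Tendsto (fun x => c * M * (ε / (2 * (c * M + 1)) +
        Real.exp D * Real.exp (-(P (x + ε / (2 * (c * M + 1))) - P x)))) l
        (nhds (c * M * (ε / (2 * (c * M + 1)) + Real.exp D * 0))) :=
      ((((Real.tendsto_exp_neg_atTop_nhds_zero.comp (hl _ ha)).const_mul _).const_add _).const_mul _)
    have lt : c * M * (ε / (2 * (c * M + 1)) + Real.exp D * 0) < ε := by
      have : 0 ≤ c * M := by positivity
      rw [mul_zero, add_zero, ← mul_div_assoc, div_lt_iff₀ (by positivity)]
      nlinarith [mul_nonneg this hε.le]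
    filter_upwards [t1.eventually_lt_const lt] with x hx
    rw [dist_zero_right, Real.norm_eq_abs]
    exact (hy2 _ ha x).trans_lt hx
  exact ⟨fun x => I x * Real.exp (P x), ⟨B1, B2, lim _ fun a ha => (hT a ha).2,
    lim _ fun a ha => (hT a ha).1⟩, hy1⟩

end main

theorem stmt13 (r q : ℝ → ℝ) (hr : Continuous r) (hrpos : ∀ x, 0 < r x)
    (hq : LocallyIntegrable q volume) (hqnn : ∀ x, 0 ≤ q x)
    (c : ℝ) (hc : 1 ≤ c) (hrc : ∀ x, c⁻¹ ≤ r x ∧ r x ≤ c) :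
    CorrectlySolvableC r q ↔
      ∀ a : ℝ, 0 < a →
        (Tendsto (fun x => ∫ t in (x - a)..(x + a), q t) atTop atTop ∧
          Tendsto (fun x => ∫ t in (x - a)..(x + a), q t) atBot atTop) := by
  have hc0 : 0 < c := by linarith
  constructor
  · rintro ⟨C, hC, H⟩ a ha
    obtain ⟨y, hy, -⟩ := (H (fun _ => 1) continuous_const ⟨1, by simp⟩).1
    constructor
    · exact nec_tendsto hr hrpos hq hqnn hc hrc hy ha
        (hy.2.2.2.comp (tendsto_atTop_add_const_right atTop (-a) tendsto_id))
    · exact nec_tendsto hr hrpos hq hqnn hc hrc hy ha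
        (hy.2.2.1.comp (tendsto_atBot_add_const_right atBot (-a) tendsto_id))
  · intro H
    have aux : ∀ a, 0 < a → ∀ l : Filter ℝ,
        Tendsto (fun x => ∫ t in (x - a / 2)..(x + a / 2), q t) l atTop →
        Tendsto (fun x : ℝ => x + a / 2) l l →
        Tendsto (fun x => PP r q (x + a) - PP r q x) l atTop := by
      intro a ha l h1 h2
      have h3 := (h1.comp h2).const_mul_atTop (inv_pos.2 hc0)
      refine tendsto_atTop_mono (fun x => ?_) h3
      have h4 := (PP_bounds hr hrpos hq hqnn hc hrc (show x ≤ x + a by linarith)).1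
      have e1 : x + a / 2 - a / 2 = x := by ring
      have e2 : x + a / 2 + a / 2 = x + a := by ring
      simp only [Function.comp, e1, e2]
      rw [inv_mul_le_iff₀ hc0]
      exact h4
    obtain ⟨B, hB, S⟩ := sufficiency hr hrpos hq hqnn hc hrc fun a ha =>
      ⟨aux a ha _ (H (a / 2) (by linarith)).1 (tendsto_atTop_add_const_right _ _ tendsto_id),
       aux a ha _ (H (a / 2) (by linarith)).2 (tendsto_atBot_add_const_right _ _ tendsto_id)⟩
    refine ⟨B, hB, fun f hf ⟨M, hM⟩ => ?_⟩
    have hbdd : BddAbove (Set.range fun t => |f t|) := ⟨M, by rintro _ ⟨t, rfl⟩; exact hM t⟩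
    obtain ⟨y, hy, hyb⟩ := S f hf (⨆ t, |f t|) fun x => le_ciSup hbdd x
    refine ⟨⟨y, hy, fun w hw => sol_unique hr hrpos hq hqnn hf hw hy⟩, fun w hw x => ?_⟩
    rw [sol_unique hr hrpos hq hqnn hf hw hy]
    exact hyb x
end
end

section
/- Suppose there exists a ∈ (0,∞) with inf_{x∈ℝ} ∫_{x−a}^{x+a} q(t)/r(t) dt > 0. Then the boundary value problem −r(x)y′(x)+q(x)y(x)=f(x), lim_{|x|→∞} y(x)=0, is correctly solvable in C(ℝ) if and only if Ã(x) := ∫_{x−d(x)}^{x+d(x)} dt/r(t) → 0 as |x| → ∞. -/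
open MeasureTheory Filter Set Real
open scoped ENNReal NNReal

noncomputable section

/-- The auxiliary function `d(x) = inf { d > 0 : ∫_{x-d}^{x+d} q(t)/r(t) dt = 2 }`. -/
def dfun (r q : ℝ → ℝ) (x : ℝ) : ℝ :=
  sInf {d : ℝ | 0 < d ∧ (∫ t in (x - d)..(x + d), q t / r t) = 2}

/-- a primitive of an everywhere interval integrable function is absolutely continuous -/
lemma prim_ac {u u' : ℝ → ℝ} (hi : ∀ a b, IntervalIntegrable u' volume a b)
    (hu : ∀ a b, u b - u a = ∫ t in a..b, u' t) (a b : ℝ) :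
    AbsolutelyContinuousOnInterval u a b := by
  have h := (hi a b).absolutelyContinuousOnInterval_intervalIntegral (c := a) (by simp)
  rw [absolutelyContinuousOnInterval_iff] at h ⊢
  simp only [Real.dist_eq] at h ⊢
  convert h using 10
  simp only [← hu]
  congr 1
  ring

lemma prim_deriv {u u' : ℝ → ℝ} (hi : ∀ a b, IntervalIntegrable u' volume a b)
    (hu : ∀ a b, u b - u a = ∫ t in a..b, u' t) (a b : ℝ) :
    ∀ᵐ x, x ∈ uIcc a b → HasDerivAt u (u' x) x := by
  filter_upwards [(hi a b).ae_hasDerivAt_integral] with x hx hxm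
  have h := (hx hxm a (by simp)).const_add (u a)
  simp only [← hu] at h
  simpa using h

lemma prim_cont {u u' : ℝ → ℝ} (hi : ∀ a b, IntervalIntegrable u' volume a b)
    (hu : ∀ a b, u b - u a = ∫ t in a..b, u' t) : Continuous u := by
  have h := (intervalIntegral.continuous_primitive hi 0).const_add (u 0)
  simp only [← hu] at h
  simpa using h

lemma prim_mul {u u' v v' : ℝ → ℝ} (hi : ∀ a b, IntervalIntegrable u' volume a b)
    (hu : ∀ a b, u b - u a = ∫ t in a..b, u' t)
    (hi2 : ∀ a b, IntervalIntegrable v' volume a b)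
    (hv : ∀ a b, v b - v a = ∫ t in a..b, v' t) (a b : ℝ) :
    u b * v b - u a * v a = ∫ t in a..b, (u' t * v t + u t * v' t) := by
  rw [← (prim_ac hi hu a b).integral_deriv_mul_eq_sub (prim_ac hi2 hv a b)]
  apply intervalIntegral.integral_congr_ae
  filter_upwards [prim_deriv hi hu a b, prim_deriv hi2 hv a b] with x h1 h2 hx
  have hx' := uIoc_subset_uIcc hx
  rw [(h1 hx').deriv, (h2 hx').deriv]

lemma lip_comp_ac {g u : ℝ → ℝ} {K : ℝ≥0} {a b : ℝ}
    (hu : AbsolutelyContinuousOnInterval u a b) (hg : LipschitzOnWith K g (u '' uIcc a b)) :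
    AbsolutelyContinuousOnInterval (fun x => g (u x)) a b := by
  rw [absolutelyContinuousOnInterval_iff] at hu ⊢
  intro ε hε
  obtain ⟨δ, hδ, h⟩ := hu (ε / (K + 1)) (by positivity)
  refine ⟨δ, hδ, fun E hE hs => ?_⟩
  have h1 := h E hE hs
  have hmem := hE.1
  calc _ ≤ ∑ i ∈ Finset.range E.1, (K + 1 : ℝ) * dist (u (E.2 i).1) (u (E.2 i).2) := by
        apply Finset.sum_le_sum
        intro i hi
        have := hg.dist_le_mul _ (mem_image_of_mem u (hmem i hi).1) _
          (mem_image_of_mem u (hmem i hi).2)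
        have h0 : 0 ≤ dist (u (E.2 i).1) (u (E.2 i).2) := dist_nonneg
        linarith
    _ < ε := by
        rw [← Finset.mul_sum]
        rw [lt_div_iff₀ (by positivity)] at h1
        linarith

lemma prim_exp {u u' : ℝ → ℝ} (hi : ∀ a b, IntervalIntegrable u' volume a b)
    (hu : ∀ a b, u b - u a = ∫ t in a..b, u' t) (a b : ℝ) :
    exp (u b) - exp (u a) = ∫ t in a..b, u' t * exp (u t) := by
  have hc := prim_cont hi hu
  have hac : AbsolutelyContinuousOnInterval (fun x => exp (u x)) a b := by
    obtain ⟨m, M, hmM⟩ : ∃ m M, u '' uIcc a b ⊆ Icc m M := by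
      have := (isCompact_uIcc (a := a) (b := b)).image hc
      exact ⟨sInf (u '' uIcc a b), sSup (u '' uIcc a b),
        fun x hx => ⟨csInf_le this.bddBelow hx, le_csSup this.bddAbove hx⟩⟩
    obtain ⟨K, hK⟩ := (Real.contDiff_exp (n := 1)).contDiffOn.exists_lipschitzOnWith (s := Icc m M)
      (by decide) (convex_Icc _ _) isCompact_Icc
    exact lip_comp_ac (prim_ac hi hu a b) (hK.mono hmM)
  rw [← hac.integral_deriv_eq_sub]
  apply intervalIntegral.integral_congr_ae
  filter_upwards [prim_deriv hi hu a b] with x h1 hx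
  rw [(h1 (uIoc_subset_uIcc hx)).exp.deriv, mul_comm]


/-! ### The function `d` -/

lemma D_spec {P : ℝ → ℝ} {K : ℝ} (hK : 0 < K) (hPc : Continuous P) (hPm : Monotone P)
    (hPK : ∀ x, P x + 2 ≤ P (x + K)) (x : ℝ) :
    let D := sInf {d : ℝ | 0 < d ∧ P (x + d) - P (x - d) = 2}
    0 < D ∧ D ≤ K ∧ P (x + D) - P (x - D) = 2 := by
  intro D
  have hset : {d : ℝ | 0 < d ∧ P (x + d) - P (x - d) = 2}
      = {d : ℝ | 0 ≤ d} ∩ {d | P (x + d) - P (x - d) = 2} := by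
    ext d
    simp only [mem_ofPred_eq, mem_inter_iff]
    refine ⟨fun h => ⟨h.1.le, h.2⟩, fun h => ⟨lt_of_le_of_ne h.1 ?_, h.2⟩⟩
    rintro rfl
    have := h.2
    norm_num at this
  have hcl : IsClosed {d : ℝ | 0 < d ∧ P (x + d) - P (x - d) = 2} := by
    rw [hset]
    exact (isClosed_le continuous_const continuous_id).inter
      (isClosed_eq (by fun_prop) continuous_const)
  have hbd : BddBelow {d : ℝ | 0 < d ∧ P (x + d) - P (x - d) = 2} := ⟨0, fun d hd => hd.1.le⟩
  obtain ⟨d, hd, hd2⟩ : ∃ d ∈ Icc 0 K, P (x + d) - P (x - d) = 2 := by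
    have h := intermediate_value_Icc hK.le
      (f := fun d => P (x + d) - P (x - d)) (by fun_prop)
    apply h
    have h1 := hPK x
    have h2 := hPm (show x - K ≤ x by linarith)
    constructor
    · simp
    · show 2 ≤ P (x + K) - P (x - K)
      linarith
  have hdm : d ∈ {d : ℝ | 0 < d ∧ P (x + d) - P (x - d) = 2} := by
    rw [hset]; exact ⟨hd.1, hd2⟩
  have hm := hcl.csInf_mem ⟨d, hdm⟩ hbd
  exact ⟨hm.1, (csInf_le hbd hdm).trans hd.2, hm.2⟩

lemma step_exists {P : ℝ → ℝ} {K : ℝ} (hK : 0 < K) (hPc : Continuous P) (hPm : Monotone P)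
    (hPK : ∀ x, P x + 2 ≤ P (x + K)) (x : ℝ) :
    ∃ s, x < s ∧ s ≤ x + K ∧ P s = P x + 2 ∧
      sInf {d : ℝ | 0 < d ∧ P ((x + s) / 2 + d) - P ((x + s) / 2 - d) = 2} = (s - x) / 2 := by
  set T : Set ℝ := {t | x ≤ t ∧ P t = P x + 2} with hT
  have hcl : IsClosed T :=
    (isClosed_le continuous_const continuous_id).inter (isClosed_eq hPc continuous_const)
  have hbd : BddBelow T := ⟨x, fun d hd => hd.1⟩
  obtain ⟨t, ht, ht2⟩ : ∃ t ∈ Icc x (x + K), P t = P x + 2 := by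
    have h := intermediate_value_Icc (show x ≤ x + K by linarith) hPc.continuousOn
    exact h ⟨by linarith, hPK x⟩
  have htm : t ∈ T := ⟨ht.1, ht2⟩
  have hm := hcl.csInf_mem ⟨t, htm⟩ hbd
  set s := sInf T with hs
  have hxs : x < s := by
    refine lt_of_le_of_ne hm.1 fun h => ?_
    have := hm.2
    rw [← h] at this
    linarith
  refine ⟨s, hxs, (csInf_le hbd htm).trans ht.2, hm.2, ?_⟩
  apply le_antisymm
  · apply csInf_le ⟨0, fun d hd => hd.1.le⟩
    refine ⟨by linarith, ?_⟩
    rw [show (x + s) / 2 + (s - x) / 2 = s by ring, show (x + s) / 2 - (s - x) / 2 = x by ring,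
      hm.2]
    ring
  · refine le_csInf ⟨(s - x) / 2, by linarith, ?_⟩ fun d hd => ?_
    · rw [show (x + s) / 2 + (s - x) / 2 = s by ring,
        show (x + s) / 2 - (s - x) / 2 = x by ring, hm.2]
      ring
    · by_contra! hlt
      have h1 := hPm (show x ≤ (x + s) / 2 - d by linarith)
      have h2 := hPm (show (x + s) / 2 + d ≤ s by linarith)
      have h3 := hd.2
      have h4 := hm.2
      have h5 : (x + s) / 2 + d ∈ T := ⟨by linarith [hd.1], by linarith⟩
      have h6 := csInf_le hbd h5
      linarith

/-! ### The weighted integral -/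

lemma W_le {P w : ℝ → ℝ} (hPc : Continuous P) (hPm : Monotone P) (hw : Continuous w)
    (hw0 : ∀ x, 0 < w x) {x b : ℝ} (hxb : x ≤ b) :
    (∫ t in x..b, exp (-P t) * w t) ≤ exp (-P x) * ∫ t in x..b, w t := by
  rw [← intervalIntegral.integral_const_mul]
  apply intervalIntegral.integral_mono_on hxb
  · exact Continuous.intervalIntegrable (by fun_prop) _ _
  · exact Continuous.intervalIntegrable (by fun_prop) _ _
  · intro t ht
    have := hPm ht.1
    have h0 := (hw0 t).le
    gcongr

lemma W_ge {P w : ℝ → ℝ} (hPc : Continuous P) (hPm : Monotone P) (hw : Continuous w)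
    (hw0 : ∀ x, 0 < w x) {x b : ℝ} (hxb : x ≤ b) :
    exp (-P b) * (∫ t in x..b, w t) ≤ ∫ t in x..b, exp (-P t) * w t := by
  rw [← intervalIntegral.integral_const_mul]
  apply intervalIntegral.integral_mono_on hxb
  · exact Continuous.intervalIntegrable (by fun_prop) _ _
  · exact Continuous.intervalIntegrable (by fun_prop) _ _
  · intro t ht
    have := hPm ht.2
    have h0 := (hw0 t).le
    gcongr

lemma int_mono {w : ℝ → ℝ} (hw : Continuous w) (hw0 : ∀ x, 0 < w x) {a b c d : ℝ}
    (h1 : c ≤ a) (h2 : a ≤ b) (h3 : b ≤ d) : (∫ t in a..b, w t) ≤ ∫ t in c..d, w t :=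
  intervalIntegral.integral_mono_interval h1 h2 h3 (Eventually.of_forall fun x => (hw0 x).le)
    (hw.intervalIntegrable _ _)

lemma int_nn {w : ℝ → ℝ} (hw0 : ∀ x, 0 < w x) {a b : ℝ} (h2 : a ≤ b) :
    0 ≤ ∫ t in a..b, w t :=
  intervalIntegral.integral_nonneg h2 fun x _ => (hw0 x).le

lemma W_step {P w : ℝ → ℝ} (hPc : Continuous P) (hPm : Monotone P) (hw : Continuous w)
    (hw0 : ∀ x, 0 < w x) {x s b C : ℝ} (hC : 0 ≤ C) (hxb : x ≤ b) (hxs : x ≤ s)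
    (hs : P s = P x + 2)
    (h : s ≤ b → (∫ t in s..b, exp (-P t) * w t) ≤ C * exp (-P s)) :
    (∫ t in x..b, exp (-P t) * w t) ≤ ((∫ t in x..s, w t) + C / 2) * exp (-P x) := by
  have e0 := exp_pos (-P x)
  rcases le_total b s with hb | hb
  · have h1 := W_le hPc hPm hw hw0 hxb
    have h2 := int_mono hw hw0 le_rfl hxb hb
    have h3 : exp (-P x) * (∫ t in x..b, w t) ≤ exp (-P x) * ∫ t in x..s, w t := by gcongr
    nlinarith
  · have hc : Continuous fun t => exp (-P t) * w t := by fun_prop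
    rw [← intervalIntegral.integral_add_adjacent_intervals
      (hc.intervalIntegrable x s) (hc.intervalIntegrable s b)]
    have h1 := W_le hPc hPm hw hw0 hxs
    have h2 := h hb
    have h3 : exp (-P s) ≤ exp (-P x) / 2 := by
      rw [hs, show -(P x + 2) = -P x - 2 by ring, exp_sub]
      have := Real.add_one_le_exp (2 : ℝ)
      gcongr
      linarith
    have h4 : C * exp (-P s) ≤ C * (exp (-P x) / 2) := by gcongr
    linarith

lemma W_bound {P w : ℝ → ℝ} (hPc : Continuous P) (hPm : Monotone P) (hw : Continuous w)
    (hw0 : ∀ x, 0 < w x) {σ : ℝ → ℝ} (hσ : ∀ x, x < σ x) (hσP : ∀ x, P (σ x) = P x + 2)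
    {A : ℝ} (hA : ∀ x, (∫ t in x..(σ x), w t) ≤ A) (x b : ℝ) (hxb : x ≤ b) :
    (∫ t in x..b, exp (-P t) * w t) ≤ 2 * A * exp (-P x) := by
  have hA0 : 0 ≤ A := (int_nn hw0 (hσ 0).le).trans (hA 0)
  have key : ∀ n : ℕ, ∀ x, x ≤ b → P b ≤ P x + 2 * n →
      (∫ t in x..b, exp (-P t) * w t) ≤ 2 * A * exp (-P x) := by
    intro n
    induction n with
    | zero =>
      intro x hx hP
      have := W_step hPc hPm hw hw0 (C := 0) le_rfl hx (hσ x).le (hσP x) (fun h => by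
        have h1 := hPm h
        have h2 := hσP x
        norm_num at hP
        linarith)
      refine this.trans ?_
      gcongr
      linarith [hA x]
    | succ n ih =>
      intro x hx hP
      have := W_step hPc hPm hw hw0 (C := 2 * A) (by linarith) hx (hσ x).le (hσP x) (fun h => by
        apply ih _ h
        rw [hσP]
        push_cast at hP
        linarith)
      refine this.trans ?_
      gcongr
      linarith [hA x]
  obtain ⟨n, hn⟩ := exists_nat_ge (P b - P x)
  exact key n x hxb (by have : (0:ℝ) ≤ n := n.cast_nonneg
                        linarith)

lemma W_lim {P w : ℝ → ℝ} (hPc : Continuous P) (hPm : Monotone P) (hw : Continuous w)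
    (hw0 : ∀ x, 0 < w x) {σ : ℝ → ℝ} (hσ : ∀ x, x < σ x) (hσP : ∀ x, P (σ x) = P x + 2)
    {A : ℝ} (hA : ∀ x, (∫ t in x..(σ x), w t) ≤ A) {l : Filter ℝ} (hl : Tendsto σ l l)
    (h0 : Tendsto (fun x => ∫ t in x..(σ x), w t) l (nhds 0)) {ε : ℝ} (hε : 0 < ε) :
    ∀ᶠ x in l, ∀ b, x ≤ b → (∫ t in x..b, exp (-P t) * w t) ≤ ε * exp (-P x) := by
  have hA0 : 0 ≤ A := (int_nn hw0 (hσ 0).le).trans (hA 0)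
  have key : ∀ n : ℕ, ∀ᶠ x in l, ∀ b, x ≤ b →
      (∫ t in x..b, exp (-P t) * w t) ≤ (2 * A * (1 / 2) ^ n + ε / 2) * exp (-P x) := by
    intro n
    induction n with
    | zero =>
      refine Eventually.of_forall fun x b hxb => ?_
      refine (W_bound hPc hPm hw hw0 hσ hσP hA x b hxb).trans ?_
      gcongr
      simp
      linarith
    | succ n ih =>
      filter_upwards [hl.eventually ih, h0.eventually_le_const (show (0:ℝ) < ε / 4 by linarith)]
        with x h1 h2 b hxb
      refine (W_step hPc hPm hw hw0 (C := 2 * A * (1 / 2) ^ n + ε / 2) (by positivity) hxb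
        (hσ x).le (hσP x) (fun h => h1 b h)).trans ?_
      refine mul_le_mul_of_nonneg_right ?_ (exp_pos _).le
      rw [pow_succ]
      linarith
  have ht : Tendsto (fun n : ℕ => 2 * A * (1 / 2 : ℝ) ^ n) atTop (nhds (2 * A * 0)) :=
    (tendsto_pow_atTop_nhds_zero_of_lt_one (by norm_num) (by norm_num)).const_mul _
  rw [mul_zero] at ht
  obtain ⟨n, hn⟩ := (ht.eventually_le_const (show (0:ℝ) < ε / 2 by linarith)).exists
  filter_upwards [key n] with x hx b hxb
  refine (hx b hxb).trans ?_
  gcongr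
  linarith

lemma growth_s14 {P : ℝ → ℝ} {a m : ℝ} (ha : 0 < a) (hm : 0 < m)
    (h : ∀ x, m ≤ P (x + a) - P (x - a)) : ∃ K, 0 < K ∧ ∀ x, P x + 2 ≤ P (x + K) := by
  have key : ∀ n : ℕ, ∀ x, P x + n * m ≤ P (x + n * (2 * a)) := by
    intro n
    induction n with
    | zero => intro x; simp
    | succ n ih =>
      intro x
      have h1 := ih x
      have h2 := h (x + n * (2 * a) + a)
      rw [show x + n * (2 * a) + a + a = x + (n + 1 : ℕ) * (2 * a) by push_cast; ring,
        show x + n * (2 * a) + a - a = x + n * (2 * a) by ring] at h2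
      push_cast at h2 ⊢
      linarith
  obtain ⟨n, hn⟩ := exists_nat_gt (2 / m)
  have hn0 : (0:ℝ) < n := lt_trans (by positivity) hn
  rw [div_lt_iff₀ hm] at hn
  exact ⟨n * (2 * a), by positivity, fun x => by linarith [key n x]⟩

lemma P_atTop {P : ℝ → ℝ} {K : ℝ} (hPm : Monotone P)
    (hPK : ∀ x, P x + 2 ≤ P (x + K)) : Tendsto P atTop atTop := by
  have key : ∀ n : ℕ, P 0 + n * 2 ≤ P (n * K) := by
    intro n
    induction n with
    | zero => simp
    | succ n ih =>
      have h2 := hPK (n * K)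
      rw [show n * K + K = (n + 1 : ℕ) * K by push_cast; ring] at h2
      push_cast at h2 ⊢
      linarith
  apply tendsto_atTop_atTop_of_monotone hPm
  intro b
  obtain ⟨n, hn⟩ := exists_nat_ge (b - P 0)
  exact ⟨n * K, by have := key n
                   have h0 : (0:ℝ) ≤ n := n.cast_nonneg
                   linarith⟩

/-! ### Solutions -/

lemma sol_identity {r q f y p P : ℝ → ℝ} (hr : Continuous r) (hrpos : ∀ x, 0 < r x)
    (hp : ∀ t, p t = q t / r t)
    (hpi : ∀ a b, IntervalIntegrable p volume a b) (hP : ∀ a b, P b - P a = ∫ t in a..b, p t)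
    (hf : Continuous f) (hyc : Continuous y)
    (hy : ∀ a b : ℝ, y b - y a = ∫ t in a..b, (q t * y t - f t) / r t) (a b : ℝ) :
    (∫ t in a..b, exp (-P t) * f t * (1 / r t)) = exp (-P a) * y a - exp (-P b) * y b := by
  have hPc := prim_cont hpi hP
  have hr0 : ∀ x, r x ≠ 0 := fun x => (hrpos x).ne'
  have hni : ∀ a b, IntervalIntegrable (fun t => -p t) volume a b := fun a b => (hpi a b).neg
  have hnP : ∀ a b, (-P b) - (-P a) = ∫ t in a..b, -p t := by
    intro a b
    rw [intervalIntegral.integral_neg, ← hP]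
    ring
  have hE := prim_exp hni hnP
  have hEi : ∀ a b, IntervalIntegrable (fun t => -p t * exp (-P t)) volume a b := fun a b =>
    (hni a b).mul_continuousOn (by fun_prop)
  have hvi : ∀ a b, IntervalIntegrable (fun t => (q t * y t - f t) / r t) volume a b := by
    intro a b
    have h1 := ((hpi a b).mul_continuousOn hyc.continuousOn).sub
      ((hf.div hr hr0).intervalIntegrable (μ := volume) a b)
    have h2 : (fun t => (q t * y t - f t) / r t) = (fun t => p t * y t) - (f / r) := by
      funext t
      simp only [hp, Pi.div_apply, Pi.sub_apply]
      ring
    rw [h2]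
    exact h1
  have h := prim_mul hEi hE hvi hy a b
  rw [← neg_inj, neg_sub, h, ← intervalIntegral.integral_neg]
  apply intervalIntegral.integral_congr
  intro t _
  simp only [hp]
  ring

lemma sol_lim {r q f y p P : ℝ → ℝ} (hr : Continuous r) (hrpos : ∀ x, 0 < r x)
    (hp : ∀ t, p t = q t / r t)
    (hpi : ∀ a b, IntervalIntegrable p volume a b) (hP : ∀ a b, P b - P a = ∫ t in a..b, p t)
    (hPt : Tendsto P atTop atTop) (hf : Continuous f) (hy : IsSolution r q f y) (a : ℝ) :
    Tendsto (fun b => ∫ t in a..b, exp (-P t) * f t * (1 / r t)) atTop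
      (nhds (exp (-P a) * y a)) := by
  simp only [sol_identity hr hrpos hp hpi hP hf hy.1 hy.2.1 a]
  have h1 : Tendsto (fun b => exp (-P b)) atTop (nhds 0) :=
    Real.tendsto_exp_atBot.comp (tendsto_neg_atTop_atBot.comp hPt)
  have h2 := (h1.mul hy.2.2.2).const_sub (exp (-P a) * y a)
  simpa using h2

lemma lim_bound {f P w : ℝ → ℝ} {x L S C : ℝ} (hPc : Continuous P) (hw : Continuous w)
    (hw0 : ∀ x, 0 < w x) (hS : ∀ t, |f t| ≤ S)
    (hL : Tendsto (fun b => ∫ t in x..b, exp (-P t) * f t * w t) atTop (nhds L))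
    (hC : ∀ b, x ≤ b → (∫ t in x..b, exp (-P t) * w t) ≤ C * exp (-P x)) :
    |L| ≤ S * C * exp (-P x) := by
  have hS0 : 0 ≤ S := (abs_nonneg _).trans (hS 0)
  refine le_of_tendsto hL.abs ?_
  filter_upwards [eventually_ge_atTop x] with b hb
  calc |∫ t in x..b, exp (-P t) * f t * w t|
      ≤ ∫ t in x..b, S * (exp (-P t) * w t) := by
        rw [← Real.norm_eq_abs]
        apply intervalIntegral.norm_integral_le_of_norm_le hb
        · refine ae_of_all _ fun t _ => ?_
          rw [Real.norm_eq_abs, abs_mul, abs_mul, abs_of_pos (exp_pos _), abs_of_pos (hw0 t)]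
          have := mul_le_mul_of_nonneg_left (hS t) (mul_pos (exp_pos (-P t)) (hw0 t)).le
          linarith
        · exact Continuous.intervalIntegrable (by fun_prop) _ _
    _ = S * ∫ t in x..b, exp (-P t) * w t := intervalIntegral.integral_const_mul _ _
    _ ≤ S * (C * exp (-P x)) := mul_le_mul_of_nonneg_left (hC b hb) hS0
    _ = _ := by ring

lemma sol_exists {r q f p P : ℝ → ℝ} (hr : Continuous r) (hrpos : ∀ x, 0 < r x)
    (hp : ∀ t, p t = q t / r t)
    (hpi : ∀ a b, IntervalIntegrable p volume a b) (hP : ∀ a b, P b - P a = ∫ t in a..b, p t)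
    (hf : Continuous f) {S A : ℝ} (hS : ∀ t, |f t| ≤ S)
    (hA : ∀ x b, x ≤ b → (∫ t in x..b, exp (-P t) * (1 / r t)) ≤ A * exp (-P x))
    (hb : ∀ ε > 0, ∀ᶠ x in atBot, ∀ b, x ≤ b →
      (∫ t in x..b, exp (-P t) * (1 / r t)) ≤ ε * exp (-P x))
    (ht : ∀ ε > 0, ∀ᶠ x in atTop, ∀ b, x ≤ b →
      (∫ t in x..b, exp (-P t) * (1 / r t)) ≤ ε * exp (-P x)) :
    ∃ y, IsSolution r q f y := by
  have hPc := prim_cont hpi hP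
  have hr0 : ∀ x, r x ≠ 0 := fun x => (hrpos x).ne'
  have hw : Continuous fun t => 1 / r t := continuous_const.div hr hr0
  have hw0 : ∀ t, 0 < 1 / r t := fun t => one_div_pos.2 (hrpos t)
  have hS0 : 0 ≤ S := (abs_nonneg _).trans (hS 0)
  set g : ℝ → ℝ := fun t => exp (-P t) * f t * (1 / r t) with hg
  have hgc : Continuous g := by
    rw [hg]
    exact (by fun_prop : Continuous fun t => exp (-P t) * f t).mul hw
  have hgi : IntegrableOn g (Ioi 0) := by
    refine integrableOn_Ioi_of_intervalIntegral_norm_bounded (S * (A * exp (-P 0))) 0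
      (b := fun x : ℝ => x) (l := atTop) (fun i => ?_) tendsto_id ?_
    · exact (hgc.integrableOn_Icc (a := 0) (b := i)).mono_set Ioc_subset_Icc_self
    · filter_upwards [eventually_ge_atTop 0] with b hb
      calc (∫ t in (0:ℝ)..b, ‖g t‖) ≤ ∫ t in (0:ℝ)..b, S * (exp (-P t) * (1 / r t)) := by
            apply intervalIntegral.integral_mono_on hb
            · exact hgc.norm.intervalIntegrable _ _
            · exact Continuous.intervalIntegrable (by fun_prop) _ _
            · intro t _
              rw [hg, Real.norm_eq_abs, abs_mul, abs_mul, abs_of_pos (exp_pos _),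
                abs_of_pos (hw0 t)]
              have := mul_le_mul_of_nonneg_left (hS t) (mul_pos (exp_pos (-P t)) (hw0 t)).le
              linarith
        _ = S * ∫ t in (0:ℝ)..b, exp (-P t) * (1 / r t) :=
            intervalIntegral.integral_const_mul _ _
        _ ≤ _ := mul_le_mul_of_nonneg_left (hA 0 b hb) hS0
  have hlim0 := intervalIntegral_tendsto_integral_Ioi 0 hgi tendsto_id
  set J := ∫ t in Ioi (0:ℝ), g t with hJ
  set v : ℝ → ℝ := fun x => J - ∫ t in (0:ℝ)..x, g t with hv
  have hlim : ∀ x, Tendsto (fun b => ∫ t in x..b, g t) atTop (nhds (v x)) := by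
    intro x
    refine (hlim0.sub_const (∫ t in (0:ℝ)..x, g t)).congr fun b => ?_
    exact intervalIntegral.integral_interval_sub_left (hgc.intervalIntegrable _ _)
      (hgc.intervalIntegrable _ _)
  have hvb : ∀ a b, v b - v a = ∫ t in a..b, -g t := by
    intro a b
    rw [intervalIntegral.integral_neg, ← intervalIntegral.integral_interval_sub_left
      (hgc.intervalIntegrable 0 b) (hgc.intervalIntegrable 0 a)]
    simp only [hv]
    ring
  have hvi : ∀ a b, IntervalIntegrable (fun t => -g t) volume a b := fun a b =>
    hgc.neg.intervalIntegrable _ _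
  have hvc := prim_cont hvi hvb
  have hest : ∀ x C, (∀ b, x ≤ b → (∫ t in x..b, exp (-P t) * (1 / r t)) ≤ C * exp (-P x)) →
      |exp (P x) * v x| ≤ S * C := by
    intro x C hC
    have h1 := lim_bound hPc hw hw0 hS (hlim x) hC
    rw [abs_mul, abs_of_pos (exp_pos _)]
    calc exp (P x) * |v x| ≤ exp (P x) * (S * C * exp (-P x)) := by gcongr
      _ = S * C * (exp (P x) * exp (-P x)) := by ring
      _ = S * C := by rw [← exp_add]; simp
  have hz : ∀ l : Filter ℝ, (∀ ε > 0, ∀ᶠ x in l, ∀ b, x ≤ b →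
      (∫ t in x..b, exp (-P t) * (1 / r t)) ≤ ε * exp (-P x)) →
      Tendsto (fun x => exp (P x) * v x) l (nhds 0) := by
    intro l hl
    rw [Metric.tendsto_nhds]
    intro ε hε
    filter_upwards [hl (ε / (S + 1)) (by positivity)] with x hx
    rw [Real.dist_eq, sub_zero]
    refine (hest x _ hx).trans_lt ?_
    rw [mul_div_assoc', div_lt_iff₀ (by positivity)]
    nlinarith
  refine ⟨fun x => exp (P x) * v x, by fun_prop, fun a b => ?_, hz _ hb, hz _ ht⟩
  have h := prim_mul (fun a b => (hpi a b).mul_continuousOn (by fun_prop))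
    (prim_exp hpi hP) hvi hvb a b
  rw [h]
  apply intervalIntegral.integral_congr
  intro t _
  have he : exp (P t) * exp (-P t) = 1 := by rw [← exp_add]; simp
  simp only [hp, hg]
  calc _ = (q t * (exp (P t) * v t) - (exp (P t) * exp (-P t)) * f t) / r t := by ring
    _ = _ := by rw [he, one_mul]


theorem stmt14 (r q : ℝ → ℝ) (hr : Continuous r) (hrpos : ∀ x, 0 < r x)
    (hq : LocallyIntegrable q volume) (hqnn : ∀ x, 0 ≤ q x)
    (a : ℝ) (ha : 0 < a) (hB : 0 < ⨅ x : ℝ, ∫ t in (x - a)..(x + a), q t / r t) :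
    CorrectlySolvableC r q ↔
      (Tendsto (fun x => ∫ t in (x - dfun r q x)..(x + dfun r q x), 1 / r t)
          atTop (nhds 0) ∧
        Tendsto (fun x => ∫ t in (x - dfun r q x)..(x + dfun r q x), 1 / r t)
          atBot (nhds 0)) := by
  have hr0 : ∀ x, r x ≠ 0 := fun x => (hrpos x).ne'
  have hw : Continuous fun t => 1 / r t := continuous_const.div hr hr0
  have hw0 : ∀ t, 0 < 1 / r t := fun t => one_div_pos.2 (hrpos t)
  set p : ℝ → ℝ := fun t => q t / r t with hpdef
  have hp : ∀ t, p t = q t / r t := fun t => rfl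
  have hp0 : ∀ t, 0 ≤ p t := fun t => div_nonneg (hqnn t) (hrpos t).le
  have hpi : ∀ a b, IntervalIntegrable p volume a b := by
    intro a b
    have hqi : IntervalIntegrable q volume a b := intervalIntegrable_iff.mpr <|
      (hq.integrableOn_isCompact isCompact_uIcc).mono_set uIoc_subset_uIcc
    have h := hqi.mul_continuousOn hw.continuousOn
    simpa [hpdef, div_eq_mul_inv] using h
  set P : ℝ → ℝ := fun x => ∫ t in (0:ℝ)..x, p t with hPdef
  have hP : ∀ a b, P b - P a = ∫ t in a..b, p t := fun a b =>
    intervalIntegral.integral_interval_sub_left (hpi _ _) (hpi _ _)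
  have hPc := prim_cont hpi hP
  have hPm : Monotone P := by
    intro x y hxy
    have := hP x y
    have h2 : 0 ≤ ∫ t in x..y, p t := intervalIntegral.integral_nonneg hxy fun t _ => hp0 t
    linarith
  obtain ⟨K, hK, hPK⟩ : ∃ K, 0 < K ∧ ∀ x, P x + 2 ≤ P (x + K) := by
    refine growth_s14 ha hB fun x => ?_
    rw [hP]
    refine ciInf_le ⟨0, ?_⟩ x
    rintro _ ⟨z, rfl⟩
    exact intervalIntegral.integral_nonneg (by linarith) fun t _ => hp0 t
  have hPt := P_atTop hPm hPK
  have hd : ∀ x, dfun r q x = sInf {d : ℝ | 0 < d ∧ P (x + d) - P (x - d) = 2} := by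
    intro x
    simp only [hP]
    rfl
  have hD := D_spec hK hPc hPm hPK
  simp only [← hd] at hD
  constructor
  · rintro ⟨c, hc, H⟩
    obtain ⟨⟨y, hy, -⟩, -⟩ := H (fun _ => 1) continuous_const ⟨1, by simp⟩
    have hle : ∀ z, (∫ t in (z - dfun r q z)..(z + dfun r q z), 1 / r t)
        ≤ exp 2 * y (z - dfun r q z) := by
      intro z
      obtain ⟨h1, h2, h3⟩ := hD z
      set x := z - dfun r q z with hx
      set b := z + dfun r q z with hb
      have hxb : x ≤ b := by linarith
      have hl := sol_lim hr hrpos hp hpi hP hPt continuous_const hy x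
      simp only [mul_one] at hl
      have hWy : (∫ t in x..b, exp (-P t) * (1 / r t)) ≤ exp (-P x) * y x := by
        refine ge_of_tendsto hl ?_
        filter_upwards [eventually_ge_atTop b] with b' hb'
        exact int_mono (w := fun t => exp (-P t) * (1 / r t)) (by fun_prop)
          (fun t => mul_pos (exp_pos _) (hw0 t)) le_rfl hxb hb'
      have hg := (W_ge hPc hPm hw hw0 hxb).trans hWy
      have e1 : exp (P b) * exp (-P b) = 1 := by rw [← exp_add]; simp
      have e2 : exp (P b) * exp (-P x) = exp 2 := by
        rw [← exp_add, show P b + -P x = 2 by linarith]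
      have := mul_le_mul_of_nonneg_left hg (exp_pos (P b)).le
      rwa [← mul_assoc, ← mul_assoc, e1, e2, one_mul] at this
    have hnn : ∀ z, 0 ≤ ∫ t in (z - dfun r q z)..(z + dfun r q z), 1 / r t := fun z =>
      int_nn hw0 (by linarith [(hD z).1])
    constructor
    · have ht : Tendsto (fun z => z - dfun r q z) atTop atTop :=
        tendsto_atTop_mono (fun z => by have := (hD z).2.1; simp only [id]; linarith)
          (tendsto_atTop_add_const_right atTop (-K) tendsto_id)
      have := (hy.2.2.2.comp ht).const_mul (exp 2)
      rw [mul_zero] at this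
      exact squeeze_zero hnn hle this
    · have ht : Tendsto (fun z => z - dfun r q z) atBot atBot :=
        tendsto_atBot_mono (fun z => by have := (hD z).1; simp only [id]; linarith) tendsto_id
      have := (hy.2.2.1.comp ht).const_mul (exp 2)
      rw [mul_zero] at this
      exact squeeze_zero hnn hle this
  · rintro ⟨hTop, hBot⟩
    choose σ hσ hσK hσP hσd using step_exists hK hPc hPm hPK
    simp only [← hd] at hσd
    have hσeq : ∀ x, (∫ t in ((x + σ x) / 2 - dfun r q ((x + σ x) / 2))..
        ((x + σ x) / 2 + dfun r q ((x + σ x) / 2)), 1 / r t) = ∫ t in x..(σ x), 1 / r t := by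
      intro x
      rw [hσd, show (x + σ x) / 2 - (σ x - x) / 2 = x by ring,
        show (x + σ x) / 2 + (σ x - x) / 2 = σ x by ring]
    have hσT : Tendsto σ atTop atTop := tendsto_atTop_mono (fun x => (hσ x).le) tendsto_id
    have hσB : Tendsto σ atBot atBot := tendsto_atBot_mono hσK
      (tendsto_atBot_add_const_right atBot K tendsto_id)
    have hBT : Tendsto (fun x => ∫ t in x..(σ x), 1 / r t) atTop (nhds 0) := by
      have hc : Tendsto (fun x => (x + σ x) / 2) atTop atTop :=
        tendsto_atTop_mono (fun x => by have := hσ x; simp only [id]; linarith) tendsto_id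
      exact (hTop.comp hc).congr hσeq
    have hBB : Tendsto (fun x => ∫ t in x..(σ x), 1 / r t) atBot (nhds 0) := by
      have hc : Tendsto (fun x => (x + σ x) / 2) atBot atBot :=
        tendsto_atBot_mono (fun x => by have := hσ x; linarith) hσB
      exact (hBot.comp hc).congr hσeq
    obtain ⟨A, hA⟩ : ∃ A, ∀ x, (∫ t in x..(σ x), 1 / r t) ≤ A := by
      obtain ⟨X, hX⟩ := eventually_atTop.1 (hBT.eventually_le_const (zero_lt_one' ℝ))
      obtain ⟨Y, hY⟩ := eventually_atBot.1 (hBB.eventually_le_const (zero_lt_one' ℝ))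
      refine ⟨max 1 (∫ t in Y..(X + K), 1 / r t), fun x => ?_⟩
      rcases le_total X x with h | h
      · exact le_max_of_le_left (hX x h)
      rcases le_total x Y with h' | h'
      · exact le_max_of_le_left (hY x h')
      exact le_max_of_le_right (int_mono hw hw0 h' (hσ x).le (by linarith [hσK x]))
    have hA0 : 0 ≤ A := (int_nn hw0 (hσ 0).le).trans (hA 0)
    have hWb := W_bound hPc hPm hw hw0 hσ hσP hA
    refine ⟨2 * A + 1, by linarith, fun f hf hM => ?_⟩
    obtain ⟨M, hM⟩ := hM
    have hS : ∀ t, |f t| ≤ ⨆ t, |f t| := fun t =>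
      le_ciSup (f := fun t => |f t|) ⟨M, by rintro _ ⟨z, rfl⟩; exact hM z⟩ t
    constructor
    · obtain ⟨y, hy⟩ := sol_exists hr hrpos hp hpi hP hf hS hWb
        (fun ε hε => W_lim hPc hPm hw hw0 hσ hσP hA hσB hBB hε)
        (fun ε hε => W_lim hPc hPm hw hw0 hσ hσP hA hσT hBT hε)
      refine ⟨y, hy, fun z hz => ?_⟩
      funext x
      have h := tendsto_nhds_unique (sol_lim hr hrpos hp hpi hP hPt hf hz x)
        (sol_lim hr hrpos hp hpi hP hPt hf hy x)
      exact mul_left_cancel₀ (exp_pos _).ne' h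
    · intro y hy x
      have h := lim_bound hPc hw hw0 hS (sol_lim hr hrpos hp hpi hP hPt hf hy x) (hWb x)
      rw [abs_mul, abs_of_pos (exp_pos _), mul_comm (exp _)] at h
      have h2 := le_of_mul_le_mul_right h (exp_pos _)
      have h3 : 0 ≤ ⨆ t, |f t| := (abs_nonneg _).trans (hS 0)
      linarith
end
end
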